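/- Let M be a loopless oriented matroid of rank r on V with a positive circuit, X its support complex, and S ⊊ V a proper subset with V − S ∈ X. Then H̃_i(X^⋆[S]; ℚ) = 0 for all i ≤ |S| − r − 2, i.e., η(X^⋆[S]) ≥ |S| − r. -/

import Mathlib

/-- An abstract simplicial complex on vertex type `V` (containing the empty face). -/
structure SimplicialCpx (V : Type*) where
  faces : Set (Finset V)
  down_closed : ∀ s ∈ faces, ∀ t ⊆ s, t ∈ faces
  empty_mem : (∅ : Finset V) ∈ faces

namespace SimplicialCpx

variable {V : Type*}

/-- `n`-dimensional chains: formal ℚ-linear combinations of faces of cardinality `n`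
(the degree is shifted by one from the usual convention: cardinality `n` faces
have topological dimension `n - 1`; cardinality `0` chains are spanned by the
empty face, giving *reduced* homology). -/
abbrev Chain (X : SimplicialCpx V) (n : ℕ) : Type _ :=
  {s : Finset V // s ∈ X.faces ∧ s.card = n} →₀ ℚ

variable [LinearOrder V]

/-- The simplicial boundary map, from chains on cardinality `n+1` faces to chains on
cardinality `n` faces, with signs determined by the linear order on the vertices. -/
noncomputable def bdry (X : SimplicialCpx V) (n : ℕ) :
    X.Chain (n + 1) →ₗ[ℚ] X.Chain n :=
  Finsupp.lsum ℚ fun s => LinearMap.toSpanSingleton ℚ (X.Chain n)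
    (∑ v ∈ s.1.attach, ((-1 : ℚ) ^ (s.1.filter (· < v.1)).card) •
      Finsupp.single ⟨s.1.erase v.1,
        ⟨X.down_closed _ s.2.1 _ (Finset.erase_subset _ _), by
          rw [Finset.card_erase_of_mem v.2, s.2.2]; rfl⟩⟩ (1 : ℚ))

/-- The cycles of cardinality `n`: all chains for `n = 0`, kernel of the boundary otherwise. -/
noncomputable def cycles (X : SimplicialCpx V) : (n : ℕ) → Submodule ℚ (X.Chain n)
  | 0 => ⊤
  | (m + 1) => LinearMap.ker (X.bdry m)

/-- Reduced simplicial homology with rational coefficients, indexed so that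
`X.redH n` is the reduced homology group `H̃_{n-1}(X; ℚ)` in the usual topological
indexing (thus `X.redH 0 = H̃_{-1}`). -/
noncomputable def redH (X : SimplicialCpx V) (n : ℕ) : Type _ :=
  (X.cycles n) ⧸ (Submodule.comap (X.cycles n).subtype (LinearMap.range (X.bdry n)))

noncomputable instance (X : SimplicialCpx V) (n : ℕ) : AddCommGroup (X.redH n) :=
  inferInstanceAs (AddCommGroup ((X.cycles n) ⧸ _))

noncomputable instance (X : SimplicialCpx V) (n : ℕ) : Module ℚ (X.redH n) :=
  inferInstanceAs (Module ℚ ((X.cycles n) ⧸ _))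

/-- `η(X) = min { j : H̃_j(X;ℚ) ≠ 0 } + 1`, which in our shifted indexing is
`min { n : X.redH n ≠ 0 }`; it is `⊤` if all reduced homology vanishes. -/
noncomputable def eta (X : SimplicialCpx V) : ℕ∞ :=
  sInf {n : ℕ∞ | ∃ m : ℕ, n = (m : ℕ∞) ∧ Nontrivial (X.redH m)}

/-- The induced subcomplex on a vertex subset `S`. -/
def induce (X : SimplicialCpx V) (S : Set V) : SimplicialCpx V where
  faces := {t | t ∈ X.faces ∧ ↑t ⊆ S}
  down_closed := fun s hs t hts =>
    ⟨X.down_closed s hs.1 t hts, subset_trans (by exact_mod_cast hts) hs.2⟩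
  empty_mem := ⟨X.empty_mem, by simp⟩

/-- The link of a face `T` in `X`. -/
def link (X : SimplicialCpx V) (T : Finset V) (hT : T ∈ X.faces) : SimplicialCpx V where
  faces := {R | Disjoint R T ∧ R ∪ T ∈ X.faces}
  down_closed := fun s hs t hts =>
    ⟨Finset.disjoint_of_subset_left hts hs.1,
     X.down_closed _ hs.2 _ (Finset.union_subset_union_left hts)⟩
  empty_mem := ⟨Finset.disjoint_empty_left T, by simpa using hT⟩

/-- The Alexander dual `X^⋆ = { T ⊆ V : V - T ∉ X }` (a simplicial complex provided
the full vertex set is not a face of `X`). -/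
def dual [Fintype V] [DecidableEq V] (X : SimplicialCpx V)
    (h : (Finset.univ : Finset V) ∉ X.faces) : SimplicialCpx V where
  faces := {T | Finset.univ \ T ∉ X.faces}
  down_closed := fun s hs t hts hmem =>
    hs (X.down_closed _ hmem _ (Finset.sdiff_subset_sdiff (subset_refl _) hts))
  empty_mem := by simpa using h

end SimplicialCpx
/-- A signed subset of `V`: a pair of disjoint finite sets of positive and
negative elements. -/
structure SignedSet (V : Type*) [DecidableEq V] where
  pos : Finset V
  neg : Finset V
  disj : Disjoint pos neg

namespace SignedSet

variable {V : Type*} [DecidableEq V]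

/-- The support of a signed set. -/
def support (C : SignedSet V) : Finset V := C.pos ∪ C.neg

/-- The negation of a signed set. -/
def negate (C : SignedSet V) : SignedSet V := ⟨C.neg, C.pos, C.disj.symm⟩

end SignedSet

/-- An oriented matroid on `V`, given by its signed circuit axioms. -/
structure OrientedMatroid (V : Type*) [DecidableEq V] where
  Circuits : Set (SignedSet V)
  support_nonempty : ∀ C ∈ Circuits, C.support.Nonempty
  negate_mem : ∀ C ∈ Circuits, C.negate ∈ Circuits
  incomparable : ∀ C ∈ Circuits, ∀ D ∈ Circuits,
    C.support ⊆ D.support → C = D ∨ C = D.negate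
  elimination : ∀ C ∈ Circuits, ∀ D ∈ Circuits, C ≠ D.negate →
    ∀ e ∈ C.pos ∩ D.neg, ∃ Z ∈ Circuits,
      Z.pos ⊆ (C.pos ∪ D.pos).erase e ∧ Z.neg ⊆ (C.neg ∪ D.neg).erase e

namespace OrientedMatroid

variable {V : Type*} [DecidableEq V]

/-- A set is independent in (the underlying matroid of) an oriented matroid if it
contains no circuit support. -/
def Indep (M : OrientedMatroid V) (S : Finset V) : Prop :=
  ∀ C ∈ M.Circuits, ¬ C.support ⊆ S

/-- The rank of (the underlying matroid of) an oriented matroid: the maximal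
cardinality of an independent set. -/
noncomputable def rank [Fintype V] (M : OrientedMatroid V) : ℕ :=
  sSup {n | ∃ S : Finset V, M.Indep S ∧ S.card = n}

/-- An oriented matroid is loopless if it has no one-element circuits. -/
def Loopless (M : OrientedMatroid V) : Prop :=
  ∀ C ∈ M.Circuits, C.support.card ≠ 1

/-- `S` is a positive circuit of `M`: the set of positive elements of a circuit
with no negative elements. -/
def PosCircuit (M : OrientedMatroid V) (S : Finset V) : Prop :=
  ∃ C ∈ M.Circuits, C.neg = ∅ ∧ C.pos = S

/-- The support complex of an oriented matroid: faces are the sets containing no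
positive circuit. -/
def suppComplex (M : OrientedMatroid V) : SimplicialCpx V where
  faces := {S | ∀ T ⊆ S, ¬ M.PosCircuit T}
  down_closed := fun s hs t hts T hTt => hs T (hTt.trans hts)
  empty_mem := by
    intro T hT hPC
    obtain ⟨C, hC, hneg, hpos⟩ := hPC
    obtain ⟨x, hx⟩ := M.support_nonempty C hC
    rw [SignedSet.support, hneg, hpos] at hx
    have : T = ∅ := Finset.subset_empty.mp hT
    subst this
    simp at hx

end OrientedMatroid

namespace SimplicialCpx

section Chains

variable {V : Type*} [LinearOrder V]

/-- The sign of `v` relative to `s`: `-1` to the number of elements of `s` below `v`. -/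
def sgn (v : V) (s : Finset V) : ℚ := (-1) ^ (s.filter (· < v)).card

lemma sgn_mul_self (v : V) (s : Finset V) : sgn v s * sgn v s = 1 := by
  rw [sgn, ← mul_pow]; simp

lemma sgn_insert_of_lt {v w : V} {s : Finset V} (hw : w ∉ s) (h : w < v) :
    sgn v (insert w s) = -sgn v s := by
  rw [sgn, sgn, Finset.filter_insert, if_pos h, Finset.card_insert_of_notMem (by simp [hw]),
    pow_succ]
  ring

lemma sgn_insert_of_not_lt {v w : V} {s : Finset V} (h : ¬ w < v) :
    sgn v (insert w s) = sgn v s := by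
  rw [sgn, sgn, Finset.filter_insert, if_neg h]

lemma sgn_erase_self (v : V) (s : Finset V) : sgn v (s.erase v) = sgn v s := by
  by_cases hv : v ∈ s
  · conv_rhs => rw [← Finset.insert_erase hv, sgn_insert_of_not_lt (lt_irrefl v)]
  · rw [Finset.erase_eq_of_notMem hv]

lemma sgn_anticomm {v w : V} {s : Finset V} (hv : v ∉ s) (hw : w ∈ s) :
    sgn v s * sgn w (insert v s) = -(sgn w s * sgn v (s.erase w)) := by
  have hne : v ≠ w := fun h => hv (h ▸ hw)
  have hws : insert w (s.erase w) = s := Finset.insert_erase hw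
  rcases lt_or_gt_of_ne hne with h | h
  · rw [sgn_insert_of_lt hv h]
    conv_lhs => rw [← hws, sgn_insert_of_not_lt (not_lt.2 h.le), hws]
    ring
  · rw [sgn_insert_of_not_lt (v := w) (not_lt.2 h.le)]
    conv_lhs => rw [← hws, sgn_insert_of_lt (Finset.notMem_erase w s) h, hws]
    ring

/-- The simplicial boundary on formal combinations of arbitrary finite sets. -/
noncomputable def boundary : (Finset V →₀ ℚ) →ₗ[ℚ] (Finset V →₀ ℚ) :=
  Finsupp.lsum ℚ fun s => LinearMap.toSpanSingleton ℚ _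
    (∑ w ∈ s, Finsupp.single (s.erase w) (sgn w s))

lemma boundary_single (s : Finset V) :
    boundary (Finsupp.single s 1) = ∑ w ∈ s, Finsupp.single (s.erase w) (sgn w s) := by
  simp [boundary]

/-- The cone operator with apex `v`. -/
noncomputable def cone (v : V) : (Finset V →₀ ℚ) →ₗ[ℚ] (Finset V →₀ ℚ) :=
  Finsupp.lsum ℚ fun s => LinearMap.toSpanSingleton ℚ _
    (if v ∈ s then 0 else Finsupp.single (insert v s) (sgn v s))

lemma cone_single (v : V) (s : Finset V) (a : ℚ) :
    cone v (Finsupp.single s a) =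
      if v ∈ s then 0 else Finsupp.single (insert v s) (a * sgn v s) := by
  by_cases h : v ∈ s <;> simp [cone, h]

/-- The operator removing the apex `v`, inverse to the cone operator. -/
noncomputable def uncone (v : V) : (Finset V →₀ ℚ) →ₗ[ℚ] (Finset V →₀ ℚ) :=
  Finsupp.lsum ℚ fun s => LinearMap.toSpanSingleton ℚ _
    (if v ∈ s then Finsupp.single (s.erase v) (sgn v s) else 0)

lemma uncone_single (v : V) (s : Finset V) (a : ℚ) :
    uncone v (Finsupp.single s a) =
      if v ∈ s then Finsupp.single (s.erase v) (a * sgn v s) else 0 := by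
  by_cases h : v ∈ s <;> simp [uncone, h]

lemma boundary_cone_add_cone_boundary (v : V) (c : Finset V →₀ ℚ) :
    boundary (cone v c) + cone v (boundary c) = c := by
  suffices h : boundary ∘ₗ cone v + cone v ∘ₗ boundary = LinearMap.id from
    LinearMap.congr_fun h c
  refine Finsupp.lhom_ext' fun s => LinearMap.ext_ring ?_
  simp only [LinearMap.comp_apply, LinearMap.add_apply, Finsupp.lsingle_apply, LinearMap.id_apply]
  rw [boundary_single, map_sum, cone_single]
  simp only [cone_single]
  by_cases hv : v ∈ s
  · rw [if_pos hv, map_zero, zero_add, Finset.sum_eq_single_of_mem v hv]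
    · rw [if_neg (Finset.notMem_erase v s), sgn_erase_self, sgn_mul_self, Finset.insert_erase hv]
    · intro w _ hwv
      rw [if_pos (Finset.mem_erase.2 ⟨hwv.symm, hv⟩)]
  · rw [if_neg hv, one_mul, ← mul_one (sgn v s), ← smul_eq_mul, ← Finsupp.smul_single, map_smul,
      boundary_single, Finset.sum_insert hv, smul_add, Finset.erase_insert hv,
      sgn_insert_of_not_lt (lt_irrefl v), Finsupp.smul_single, smul_eq_mul, sgn_mul_self,
      Finset.smul_sum, add_assoc, ← Finset.sum_add_distrib]
    refine add_eq_left.2 (Finset.sum_eq_zero fun w hw => ?_)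
    have hne : v ≠ w := fun h => hv (h ▸ hw)
    rw [if_neg (fun h => hv (Finset.mem_of_mem_erase h)), Finsupp.smul_single, smul_eq_mul,
      sgn_anticomm hv hw, Finset.erase_insert_of_ne hne, ← Finsupp.single_add]
    simp

lemma boundary_boundary (c : Finset V →₀ ℚ) : boundary (boundary c) = 0 := by
  suffices h : (boundary ∘ₗ boundary : (Finset V →₀ ℚ) →ₗ[ℚ] _) = 0 from LinearMap.congr_fun h c
  refine Finsupp.lhom_ext' fun s => LinearMap.ext_ring ?_
  simp only [LinearMap.comp_apply, Finsupp.lsingle_apply, LinearMap.zero_apply]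
  induction s using Finset.induction_on with
  | empty => simp [boundary_single]
  | insert v s hv ih =>
    have hs : Finsupp.single (insert v s) (1 : ℚ) = sgn v s • cone v (Finsupp.single s 1) := by
      rw [cone_single, if_neg hv, Finsupp.smul_single, smul_eq_mul, one_mul, sgn_mul_self]
    have h₁ : boundary (cone v (Finsupp.single s (1 : ℚ))) =
        Finsupp.single s 1 - cone v (boundary (Finsupp.single s 1)) :=
      eq_sub_of_add_eq (boundary_cone_add_cone_boundary v _)
    have h₂ := boundary_cone_add_cone_boundary v (boundary (Finsupp.single s (1 : ℚ)))
    rw [ih, map_zero, add_zero] at h₂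
    rw [hs, map_smul, map_smul, h₁, map_sub, h₂, sub_self, smul_zero]

/-- The chains supported on the members of `F` of cardinality `n`. -/
noncomputable abbrev chains (F : Set (Finset V)) (n : ℕ) : Submodule ℚ (Finset V →₀ ℚ) :=
  Finsupp.supported ℚ ℚ {s | s ∈ F ∧ s.card = n}

lemma map_mem_of_supported {V : Type*} {A : Set (Finset V)} {N : Submodule ℚ (Finset V →₀ ℚ)}
    (f : (Finset V →₀ ℚ) →ₗ[ℚ] (Finset V →₀ ℚ))
    (hf : ∀ s ∈ A, f (Finsupp.single s 1) ∈ N) {c : Finset V →₀ ℚ}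
    (hc : c ∈ Finsupp.supported ℚ ℚ A) : f c ∈ N := by
  rw [Finsupp.supported_eq_span_single] at hc
  have : Submodule.span ℚ ((fun i => Finsupp.single i (1 : ℚ)) '' A) ≤ N.comap f := by
    rw [Submodule.span_le]
    rintro _ ⟨s, hs, rfl⟩
    exact hf s hs
  exact this hc

lemma boundary_mem_chains {F : Set (Finset V)} (hF : ∀ s ∈ F, ∀ t ⊆ s, t ∈ F) {n : ℕ}
    {c : Finset V →₀ ℚ} (hc : c ∈ chains F (n + 1)) : boundary c ∈ chains F n := by
  refine map_mem_of_supported _ ?_ hc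
  rintro s ⟨hs, hn⟩
  rw [boundary_single]
  refine Submodule.sum_mem _ fun w hw => Finsupp.single_mem_supported _ _
    ⟨hF s hs _ (Finset.erase_subset _ _), ?_⟩
  rw [Finset.card_erase_of_mem hw, hn, Nat.add_sub_cancel]

lemma boundary_eq_zero {F : Set (Finset V)} {c : Finset V →₀ ℚ} (hc : c ∈ chains F 0) :
    boundary c = 0 := by
  suffices h : boundary c ∈ (⊥ : Submodule ℚ (Finset V →₀ ℚ)) by simpa using h
  refine map_mem_of_supported _ ?_ hc
  rintro s ⟨-, hs⟩
  simp [boundary_single, Finset.card_eq_zero.1 hs]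

lemma cone_mem_chains {F G : Set (Finset V)} {v : V}
    (h : ∀ s ∈ F, v ∉ s → insert v s ∈ G) {n : ℕ} {c : Finset V →₀ ℚ}
    (hc : c ∈ chains F n) : cone v c ∈ chains G (n + 1) := by
  refine map_mem_of_supported _ ?_ hc
  rintro s ⟨hs, hn⟩
  rw [cone_single]
  split_ifs with hv
  · exact Submodule.zero_mem _
  · exact Finsupp.single_mem_supported _ _
      ⟨h s hs hv, by rw [Finset.card_insert_of_notMem hv, hn]⟩

lemma uncone_cone {v : V} {F : Set (Finset V)} (hF : ∀ s ∈ F, v ∉ s) {n : ℕ}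
    {c : Finset V →₀ ℚ} (hc : c ∈ chains F n) : uncone v (cone v c) = c := by
  let f : (Finset V →₀ ℚ) →ₗ[ℚ] (Finset V →₀ ℚ) := uncone v ∘ₗ cone v - LinearMap.id
  suffices h : f c ∈ (⊥ : Submodule ℚ (Finset V →₀ ℚ)) by
    simpa [f, sub_eq_zero] using h
  refine map_mem_of_supported _ ?_ hc
  rintro s ⟨hs, -⟩
  simp [f, cone_single, uncone_single, hF s hs, sgn_insert_of_not_lt,
    sgn_mul_self]

lemma uncone_eq_zero {v : V} {F : Set (Finset V)} (hF : ∀ s ∈ F, v ∉ s) {n : ℕ}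
    {c : Finset V →₀ ℚ} (hc : c ∈ chains F n) : uncone v c = 0 := by
  suffices h : uncone v c ∈ (⊥ : Submodule ℚ (Finset V →₀ ℚ)) by simpa using h
  refine map_mem_of_supported _ ?_ hc
  rintro s ⟨hs, -⟩
  simp [uncone_single, hF s hs]

/-- Every cycle on the members of `F` of cardinality `n` bounds in `F`. -/
def CyclesBound (F : Set (Finset V)) (n : ℕ) : Prop :=
  ∀ c ∈ chains F n, boundary c = 0 → ∃ b ∈ chains F (n + 1), boundary b = c

lemma cyclesBound_of_cone {F : Set (Finset V)} {v : V} (h : ∀ s ∈ F, insert v s ∈ F) (n : ℕ) :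
    CyclesBound F n := by
  intro c hc hd
  refine ⟨cone v c, cone_mem_chains (fun s hs _ => h s hs) hc, ?_⟩
  simpa [hd] using boundary_cone_add_cone_boundary v c

/-- If `L` is the link of `v` in `F` and `K` its deletion, and `K` is one half of a pair of
complexes meeting inside `L` whose union has no homology, then cycles of `F` bound. -/
lemma CyclesBound.of_link_of_union {F K L G : Set (Finset V)} {v : V} {n : ℕ}
    (hF : ∀ s ∈ F, ∀ t ⊆ s, t ∈ F)
    (hK : ∀ s, s ∈ K ↔ s ∈ F ∧ v ∉ s) (hL : ∀ s, s ∈ L ↔ insert v s ∈ F ∧ v ∉ s)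
    (hG : ∀ s ∈ G, ∀ t ⊆ s, t ∈ G) (hKG : K ∩ G ⊆ L)
    (hlink : ∀ m, n = m + 1 → CyclesBound L m) (hunion : CyclesBound (K ∪ G) n) :
    CyclesBound F n := by
  have hLK : ∀ s ∈ L, s ∈ K := fun s hs =>
    (hK s).2 ⟨hF _ ((hL s).1 hs).1 _ (Finset.subset_insert _ _), ((hL s).1 hs).2⟩
  have hKd : ∀ s ∈ K, ∀ t ⊆ s, t ∈ K := fun s hs t hts =>
    (hK t).2 ⟨hF s ((hK s).1 hs).1 t hts, fun h => ((hK s).1 hs).2 (hts h)⟩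
  have hLd : ∀ s ∈ L, ∀ t ⊆ s, t ∈ L := fun s hs t hts =>
    (hL t).2 ⟨hF _ ((hL s).1 hs).1 _ (Finset.insert_subset_insert _ hts),
      fun h => ((hL s).1 hs).2 (hts h)⟩
  have hcone : ∀ {m : ℕ} {c : Finset V →₀ ℚ}, c ∈ chains L m → cone v c ∈ chains F (m + 1) :=
    fun hc => cone_mem_chains (fun s hs _ => ((hL s).1 hs).1) hc
  have hKF : ∀ {m : ℕ}, chains K m ≤ chains F m := fun {m} =>
    Finsupp.supported_mono fun s hs => ⟨((hK s).1 hs.1).1, hs.2⟩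
  have hLK' : ∀ {m : ℕ}, chains L m ≤ chains K m := fun {m} =>
    Finsupp.supported_mono fun s hs => ⟨hLK s hs.1, hs.2⟩
  have hdel : ∀ z ∈ chains K n, boundary z = 0 → ∃ b ∈ chains F (n + 1), boundary b = z := by
    intro z hz hdz
    have hzU : z ∈ chains (K ∪ G) n := by
      refine Finsupp.supported_mono ?_ hz
      exact fun s hs => ⟨Or.inl hs.1, hs.2⟩
    obtain ⟨y, hy, hdy⟩ := hunion z hzU hdz
    have hy' : y ∈ chains K (n + 1) ⊔ chains G (n + 1) := by
      rw [← Finsupp.supported_union]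
      refine Finsupp.supported_mono ?_ hy
      rintro s ⟨hs | hs, hn⟩
      exacts [Or.inl ⟨hs, hn⟩, Or.inr ⟨hs, hn⟩]
    obtain ⟨a, ha, b, hb, rfl⟩ := Submodule.mem_sup.1 hy'
    have hdb : boundary b = z - boundary a := by rw [← hdy, map_add]; abel
    have hu : boundary b ∈ chains L n := by
      have h₁ : boundary b ∈ chains K n := hdb ▸ Submodule.sub_mem _ hz (boundary_mem_chains hKd ha)
      have h₂ : boundary b ∈ chains G n := boundary_mem_chains hG hb
      rw [Finsupp.mem_supported] at h₁ h₂ ⊢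
      exact fun s hs => ⟨hKG ⟨(h₁ hs).1, (h₂ hs).1⟩, (h₁ hs).2⟩
    refine ⟨a + cone v (boundary b), Submodule.add_mem _ (hKF ha) (hcone hu), ?_⟩
    have h := boundary_cone_add_cone_boundary v (boundary b)
    rw [boundary_boundary, map_zero, add_zero] at h
    rw [map_add, h, hdb]
    abel
  intro c hc hdc
  rcases n with _ | m
  · refine hdel c ?_ hdc
    rw [Finsupp.mem_supported] at hc ⊢
    intro s hs
    refine ⟨(hK s).2 ⟨(hc hs).1, ?_⟩, (hc hs).2⟩
    simp [Finset.card_eq_zero.1 (hc hs).2]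
  · have hsplit : c ∈ chains K (m + 1) ⊔ (chains L m).map (cone v) := by
      refine map_mem_of_supported LinearMap.id ?_ hc
      rintro s ⟨hs, hn⟩
      by_cases hv : v ∈ s
      · refine Submodule.mem_sup_right ⟨Finsupp.single (s.erase v) (sgn v s), ?_, ?_⟩
        · refine Finsupp.single_mem_supported _ _ ⟨(hL _).2 ⟨?_, Finset.notMem_erase v s⟩, ?_⟩
          · rwa [Finset.insert_erase hv]
          · rw [Finset.card_erase_of_mem hv, hn, Nat.add_sub_cancel]
        · rw [cone_single, if_neg (Finset.notMem_erase v s), Finset.insert_erase hv,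
            sgn_erase_self, sgn_mul_self, LinearMap.id_apply]
      · exact Submodule.mem_sup_left
          (Finsupp.single_mem_supported _ _ ⟨(hK s).2 ⟨hs, hv⟩, hn⟩)
    obtain ⟨c₀, hc₀, _, ⟨c₁, hc₁, rfl⟩, rfl⟩ := Submodule.mem_sup.1 hsplit
    have hnot : ∀ s ∈ K, v ∉ s := fun s hs => ((hK s).1 hs).2
    have hbc := boundary_cone_add_cone_boundary v c₁
    have hdc₁ : boundary c₁ = 0 := by
      rcases m with _ | k
      · exact boundary_eq_zero hc₁
      · have hd₁ : boundary c₁ ∈ chains K k := hLK' (boundary_mem_chains hLd hc₁)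
        rw [map_add, eq_sub_of_add_eq hbc] at hdc
        have h := congrArg (uncone v) hdc
        rw [map_add, map_sub, uncone_cone hnot hd₁, uncone_eq_zero hnot (hLK' hc₁),
          uncone_eq_zero hnot (boundary_mem_chains hKd hc₀)] at h
        simpa using h
    obtain ⟨b, hb, hdb⟩ := hlink m rfl c₁ hc₁ hdc₁
    have hbb := boundary_cone_add_cone_boundary v b
    rw [hdb] at hbb
    have hz : c₀ + b = c₀ + cone v c₁ + boundary (cone v b) := by
      rw [add_assoc, add_comm (cone v c₁), hbb]
    obtain ⟨y, hy, hdy⟩ := hdel (c₀ + b) (Submodule.add_mem _ hc₀ (hLK' hb)) (by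
      rw [hz, map_add, hdc, boundary_boundary, add_zero])
    exact ⟨y - cone v b, Submodule.sub_mem _ hy (hcone hb), by rw [map_sub, hdy, hz]; abel⟩

lemma boundary_mapDomain (X : SimplicialCpx V) (n : ℕ) (c : X.Chain (n + 1)) :
    boundary (Finsupp.mapDomain Subtype.val c) = Finsupp.mapDomain Subtype.val (X.bdry n c) := by
  suffices h : boundary ∘ₗ Finsupp.lmapDomain ℚ ℚ Subtype.val =
      Finsupp.lmapDomain ℚ ℚ Subtype.val ∘ₗ X.bdry n from LinearMap.congr_fun h c
  refine Finsupp.lhom_ext' fun s => LinearMap.ext_ring ?_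
  simp only [LinearMap.comp_apply, Finsupp.lsingle_apply, Finsupp.lmapDomain_apply,
    Finsupp.mapDomain_single, boundary_single, bdry, Finsupp.lsum_single,
    LinearMap.toSpanSingleton_apply, one_smul]
  rw [← Finsupp.lmapDomain_apply ℚ ℚ, map_sum, ← Finset.sum_attach]
  refine Finset.sum_congr rfl fun w _ => ?_
  simp [sgn, Finsupp.mapDomain_single]

lemma mapDomain_mem_chains (X : SimplicialCpx V) (n : ℕ) (c : X.Chain n) :
    Finsupp.mapDomain Subtype.val c ∈ chains X.faces n := by
  rw [Finsupp.mem_supported]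
  intro s hs
  obtain ⟨t, -, rfl⟩ := Finset.mem_image.1 (Finsupp.mapDomain_support hs)
  exact t.2

lemma exists_mapDomain_eq {V : Type*} (X : SimplicialCpx V) {n : ℕ} {b : Finset V →₀ ℚ}
    (hb : b ∈ chains X.faces n) : ∃ c : X.Chain n, Finsupp.mapDomain Subtype.val c = b := by
  refine ⟨b.comapDomain Subtype.val Subtype.val_injective.injOn,
    Finsupp.mapDomain_comapDomain _ Subtype.val_injective _ ?_⟩
  rw [Finsupp.mem_supported] at hb
  exact fun s hs => ⟨⟨s, hb hs⟩, rfl⟩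

lemma CyclesBound.subsingleton_redH {X : SimplicialCpx V} {n : ℕ}
    (h : CyclesBound X.faces n) : Subsingleton (X.redH n) := by
  refine Submodule.Quotient.subsingleton_iff.2 (eq_top_iff.2 ?_)
  rintro ⟨c, hc⟩ -
  have hd : boundary (Finsupp.mapDomain Subtype.val c) = 0 := by
    rcases n with _ | m
    · exact boundary_eq_zero (mapDomain_mem_chains X 0 c)
    · rw [boundary_mapDomain, LinearMap.mem_ker.1 hc, Finsupp.mapDomain_zero]
  obtain ⟨b, hb, hdb⟩ := h _ (mapDomain_mem_chains X n c) hd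
  obtain ⟨b, rfl⟩ := exists_mapDomain_eq X hb
  refine ⟨b, Finsupp.mapDomain_injective Subtype.val_injective ?_⟩
  rw [← boundary_mapDomain, hdb]
  rfl

end Chains

end SimplicialCpx

namespace SignedSet

variable {V : Type*} [DecidableEq V]

/-- Removal of an element from a signed set. -/
def erase (C : SignedSet V) (v : V) : SignedSet V :=
  ⟨C.pos.erase v, C.neg.erase v,
    Finset.disjoint_of_subset_left (Finset.erase_subset _ _)
      (Finset.disjoint_of_subset_right (Finset.erase_subset _ _) C.disj)⟩

lemma support_erase (C : SignedSet V) (v : V) : (C.erase v).support = C.support.erase v :=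
  (Finset.erase_union_distrib _ _ _).symm

/-- A family of non-empty signed sets, closed under negation, with weak elimination: the signed
circuit axioms without incomparability. Unlike the latter, these pass to `contract`. -/
structure Eliminative (𝒞 : Set (SignedSet V)) : Prop where
  support_nonempty : ∀ C ∈ 𝒞, C.support.Nonempty
  negate_mem : ∀ C ∈ 𝒞, C.negate ∈ 𝒞
  elimination : ∀ C ∈ 𝒞, ∀ D ∈ 𝒞, C ≠ D.negate → ∀ e ∈ C.pos ∩ D.neg, ∃ Z ∈ 𝒞,
    Z.pos ⊆ (C.pos ∪ D.pos).erase e ∧ Z.neg ⊆ (C.neg ∪ D.neg).erase e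

/-- Contraction of a family of signed sets by an element. -/
def contract (𝒞 : Set (SignedSet V)) (v : V) : Set (SignedSet V) :=
  {Z | ∃ C ∈ 𝒞, C.erase v = Z ∧ Z.support.Nonempty}

lemma Eliminative.support_erase_nonempty {𝒞 : Set (SignedSet V)} (h𝒞 : Eliminative 𝒞) {v : V}
    (hv : ∀ C ∈ 𝒞, C.support ≠ {v}) {C : SignedSet V} (hC : C ∈ 𝒞) :
    (C.erase v).support.Nonempty := by
  rw [support_erase, Finset.nonempty_iff_ne_empty, Ne, Finset.erase_eq_empty_iff, not_or]
  exact ⟨(h𝒞.support_nonempty C hC).ne_empty, hv C hC⟩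

lemma Eliminative.contract {𝒞 : Set (SignedSet V)} (h𝒞 : Eliminative 𝒞) {v : V}
    (hv : ∀ C ∈ 𝒞, C.support ≠ {v}) : Eliminative (contract 𝒞 v) where
  support_nonempty := by
    rintro _ ⟨C, -, -, h⟩
    exact h
  negate_mem := by
    rintro _ ⟨C, hC, rfl, h⟩
    exact ⟨C.negate, h𝒞.negate_mem C hC, rfl,
      h𝒞.support_erase_nonempty hv (h𝒞.negate_mem C hC)⟩
  elimination := by
    rintro _ ⟨C, hC, rfl, -⟩ _ ⟨D, hD, rfl, -⟩ hne e he
    have he' : e ∈ C.pos ∩ D.neg := by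
      simp only [erase, Finset.mem_inter, Finset.mem_erase] at he ⊢
      exact ⟨he.1.2, he.2.2⟩
    obtain ⟨Z, hZ, hp, hn⟩ := h𝒞.elimination C hC D hD (by rintro rfl; exact hne rfl) e he'
    refine ⟨Z.erase v, ⟨Z, hZ, rfl, h𝒞.support_erase_nonempty hv hZ⟩, ?_, ?_⟩
    · simp only [erase, ← Finset.erase_union_distrib]
      rw [Finset.erase_right_comm]
      exact Finset.erase_subset_erase _ hp
    · simp only [erase, ← Finset.erase_union_distrib]
      rw [Finset.erase_right_comm]
      exact Finset.erase_subset_erase _ hn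

/-- The subsets `F` of `W` for which `T ∪ (W \ F)` contains a positive member of `𝒞`: the
Alexander dual, on the ground set `W`, of the link of `T`. -/
def dualLink (𝒞 : Set (SignedSet V)) (T W : Finset V) : Set (Finset V) :=
  {F | F ⊆ W ∧ ∃ C ∈ 𝒞, C.neg = ∅ ∧ C.pos ⊆ T ∪ (W \ F)}

lemma dualLink_down_closed {𝒞 : Set (SignedSet V)} {T W s : Finset V}
    (hs : s ∈ dualLink 𝒞 T W) (t : Finset V) (hts : t ⊆ s) : t ∈ dualLink 𝒞 T W := by
  obtain ⟨hsW, C, hC, hn, hp⟩ := hs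
  exact ⟨hts.trans hsW, C, hC, hn, hp.trans
    (Finset.union_subset_union_right (Finset.sdiff_subset_sdiff subset_rfl hts))⟩

lemma mem_dualLink_erase_insert {𝒞 : Set (SignedSet V)} {T W : Finset V} {v : V} (hv : v ∈ W)
    (s : Finset V) :
    s ∈ dualLink 𝒞 (insert v T) (W.erase v) ↔ s ∈ dualLink 𝒞 T W ∧ v ∉ s := by
  have key : ∀ s : Finset V, v ∉ s → insert v T ∪ (W.erase v \ s) = T ∪ (W \ s) := by
    intro s hs
    ext x
    by_cases hx : x = v
    · subst hx; simp [hv, hs]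
    · simp [hx]
  constructor
  · rintro ⟨hs, h⟩
    have hvs : v ∉ s := fun h => Finset.notMem_erase v W (hs h)
    rw [key s hvs] at h
    exact ⟨⟨hs.trans (Finset.erase_subset _ _), h⟩, hvs⟩
  · rintro ⟨⟨hs, h⟩, hvs⟩
    refine ⟨Finset.subset_erase.2 ⟨hs, hvs⟩, ?_⟩
    rwa [key s hvs]

lemma mem_dualLink_erase {𝒞 : Set (SignedSet V)} {T W : Finset V} {v : V} (hv : v ∈ W)
    (s : Finset V) :
    s ∈ dualLink 𝒞 T (W.erase v) ↔ insert v s ∈ dualLink 𝒞 T W ∧ v ∉ s := by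
  have key : W.erase v \ s = W \ insert v s := by
    ext x
    simp only [Finset.mem_sdiff, Finset.mem_erase, Finset.mem_insert]
    tauto
  simp only [dualLink, Set.mem_ofPred_eq, key, Finset.insert_subset_iff, Finset.subset_erase, hv,
    true_and]
  tauto

/-- The subsets `F` of `W` for which `T ∪ (W \ F)` contains a positive member of `𝒞` after
reorientation of `v`. -/
def reorientedDualLink (𝒞 : Set (SignedSet V)) (v : V) (T W : Finset V) : Set (Finset V) :=
  {F | F ⊆ W ∧ ∃ C ∈ 𝒞, C.neg ⊆ {v} ∧ C.pos ⊆ T ∪ (W \ F)}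

lemma Eliminative.dualLink_inter_subset {𝒞 : Set (SignedSet V)} (h𝒞 : Eliminative 𝒞) {v : V}
    (hv : ∀ C ∈ 𝒞, C.support ≠ {v}) {T W : Finset V} :
    dualLink 𝒞 (insert v T) W ∩ reorientedDualLink 𝒞 v T W ⊆ dualLink 𝒞 T W := by
  rintro s ⟨⟨hs, C, hC, hCn, hCp⟩, -, D, hD, hDn, hDp⟩
  refine ⟨hs, ?_⟩
  rw [Finset.insert_union, Finset.subset_insert_iff] at hCp
  by_cases hvC : v ∈ C.pos
  · rcases Finset.subset_singleton_iff.1 hDn with hDn | hDn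
    · exact ⟨D, hD, hDn, hDp⟩
    · have hne : C ≠ D.negate := by
        rintro rfl
        refine hv D hD ?_
        have hDp : D.pos = ∅ := hCn
        rw [support, hDn, hDp, Finset.empty_union]
      obtain ⟨Z, hZ, hZp, hZn⟩ := h𝒞.elimination C hC D hD hne v (by simp [hvC, hDn])
      refine ⟨Z, hZ, ?_, hZp.trans ?_⟩
      · rw [hCn, hDn] at hZn
        simpa using hZn
      · rw [Finset.erase_union_distrib]
        exact Finset.union_subset hCp ((Finset.erase_subset _ _).trans hDp)
  · rw [Finset.erase_eq_of_notMem hvC] at hCp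
    exact ⟨C, hC, hCn, hCp⟩

lemma Eliminative.dualLink_union {𝒞 : Set (SignedSet V)} (h𝒞 : Eliminative 𝒞) {v : V}
    (hv : ∀ C ∈ 𝒞, C.support ≠ {v}) {T W : Finset V} :
    dualLink 𝒞 (insert v T) W ∪ reorientedDualLink 𝒞 v T W =
      dualLink (SignedSet.contract 𝒞 v) T W := by
  ext s
  constructor
  · rintro (⟨hs, C, hC, hCn, hCp⟩ | ⟨hs, C, hC, hCn, hCp⟩)
    · refine ⟨hs, C.erase v, ⟨C, hC, rfl, h𝒞.support_erase_nonempty hv hC⟩, ?_, ?_⟩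
      · simp [erase, hCn]
      · rwa [Finset.insert_union, Finset.subset_insert_iff] at hCp
    · refine ⟨hs, C.erase v, ⟨C, hC, rfl, h𝒞.support_erase_nonempty hv hC⟩, ?_, ?_⟩
      · exact Finset.erase_eq_empty_iff _ _ |>.2 (Finset.subset_singleton_iff.1 hCn)
      · exact (Finset.erase_subset _ _).trans hCp
  · rintro ⟨hs, _, ⟨C, hC, rfl, -⟩, hn, hp⟩
    simp only [erase] at hn hp
    rcases (Finset.erase_eq_empty_iff _ _).1 hn with hn | hn
    · exact Or.inl ⟨hs, C, hC, hn, by rwa [Finset.insert_union, Finset.subset_insert_iff]⟩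
    · have hvC : v ∉ C.pos := Finset.disjoint_right.1 C.disj (by simp [hn])
      rw [Finset.erase_eq_of_notMem hvC] at hp
      exact Or.inr ⟨hs, C, hC, hn.subset, hp⟩

lemma Eliminative.exists_pos_eq_of_support_eq {𝒞 : Set (SignedSet V)} (h𝒞 : Eliminative 𝒞)
    {C : SignedSet V} (hC : C ∈ 𝒞) {v : V} (hv : C.support = {v}) :
    ∃ D ∈ 𝒞, D.neg = ∅ ∧ D.pos = {v} := by
  have hp : C.pos ⊆ {v} := hv ▸ Finset.subset_union_left
  have hn : C.neg ⊆ {v} := hv ▸ Finset.subset_union_right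
  have hd := C.disj
  rcases Finset.subset_singleton_iff.1 hp with hp | hp
  · rw [support, hp, Finset.empty_union] at hv
    exact ⟨C.negate, h𝒞.negate_mem C hC, hp, hv⟩
  · rcases Finset.subset_singleton_iff.1 hn with hn | hn
    · exact ⟨C, hC, hn, hp⟩
    · simp [hp, hn] at hd

lemma cyclesBound_of_forall_subset_mem {V : Type*} [LinearOrder V] {𝒞 : Set (SignedSet V)}
    {T W : Finset V} (hW : W.Nonempty) {C : SignedSet V} (hC : C ∈ 𝒞) (hCn : C.neg = ∅)
    (hCp : C.pos ⊆ T) (n : ℕ) : SimplicialCpx.CyclesBound (dualLink 𝒞 T W) n := by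
  obtain ⟨v, hv⟩ := hW
  refine SimplicialCpx.cyclesBound_of_cone (v := v) ?_ n
  rintro s ⟨hs, -⟩
  exact ⟨Finset.insert_subset hv hs, C, hC, hCn, hCp.trans Finset.subset_union_left⟩

theorem Eliminative.cyclesBound_dualLink {V : Type*} [LinearOrder V] {𝒞 : Set (SignedSet V)}
    (h𝒞 : Eliminative 𝒞) {T W : Finset V} (hT : T.Nonempty) (hTW : Disjoint T W) {r : ℕ}
    (hr : ∀ I ⊆ T ∪ W, (∀ C ∈ 𝒞, ¬ C.support ⊆ I) → I.card ≤ r) {n : ℕ}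
    (hn : n + r + 1 ≤ W.card) : SimplicialCpx.CyclesBound (dualLink 𝒞 T W) n := by
  induction hk : W.card generalizing 𝒞 T W r n with
  | zero => omega
  | succ k ih =>
    have hWne : W.Nonempty := Finset.card_pos.1 (by omega)
    by_cases hacyc : ∃ C ∈ 𝒞, C.neg = ∅ ∧ C.pos ⊆ T
    · obtain ⟨C, hC, hCn, hCp⟩ := hacyc
      exact cyclesBound_of_forall_subset_mem hWne hC hCn hCp n
    have hsingle : ∀ x ∈ T ∪ W, (∀ C ∈ 𝒞, C.support ≠ {x}) → 1 ≤ r := by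
      intro x hx h
      refine hr {x} (Finset.singleton_subset_iff.2 hx) fun C hC hsub => ?_
      rcases Finset.subset_singleton_iff.1 hsub with h' | h'
      · exact (h𝒞.support_nonempty C hC).ne_empty h'
      · exact h C hC h'
    have hr1 : 1 ≤ r := by
      obtain ⟨t, ht⟩ := hT
      refine hsingle t (Finset.mem_union_left _ ht) fun C hC hsupp => hacyc ?_
      obtain ⟨D, hD, hDn, hDp⟩ := h𝒞.exists_pos_eq_of_support_eq hC hsupp
      exact ⟨D, hD, hDn, by simpa [hDp] using ht⟩
    obtain ⟨v, hv⟩ := hWne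
    have hvT : v ∉ T := Finset.disjoint_right.1 hTW hv
    have hcard : (W.erase v).card = k := by rw [Finset.card_erase_of_mem hv, hk]; rfl
    have hdisj : Disjoint T (W.erase v) :=
      Finset.disjoint_of_subset_right (Finset.erase_subset _ _) hTW
    have hsub : T ∪ W.erase v ⊆ T ∪ W :=
      Finset.union_subset_union_right (Finset.erase_subset _ _)
    have hlink : ∀ m, n = m + 1 →
        SimplicialCpx.CyclesBound (dualLink 𝒞 T (W.erase v)) m := fun m hm =>
      ih h𝒞 hT hdisj (fun I hI => hr I (hI.trans hsub)) (by omega) hcard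
    by_cases hloop : ∀ C ∈ 𝒞, C.support ≠ {v}
    · refine SimplicialCpx.CyclesBound.of_link_of_union
        (G := reorientedDualLink 𝒞 v T (W.erase v)) (fun s hs => dualLink_down_closed hs)
        (mem_dualLink_erase_insert hv) (mem_dualLink_erase hv) ?_
        (h𝒞.dualLink_inter_subset hloop) hlink ?_
      · rintro s ⟨hs, C, hC, hCn, hCp⟩ t hts
        exact ⟨hts.trans hs, C, hC, hCn, hCp.trans
          (Finset.union_subset_union_right (Finset.sdiff_subset_sdiff subset_rfl hts))⟩
      · rw [h𝒞.dualLink_union hloop]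
        refine ih (h𝒞.contract hloop) hT hdisj (r := r - 1) (fun I hI hind => ?_)
          (by omega) hcard
        have hvI : v ∉ I := fun h => by simpa [hvT] using hI h
        have := hr (insert v I)
          (Finset.insert_subset (Finset.mem_union_right _ hv) (hI.trans hsub)) fun C hC hCI => by
            refine hind (C.erase v) ⟨C, hC, rfl, h𝒞.support_erase_nonempty hloop hC⟩ ?_
            rwa [support_erase, ← Finset.subset_insert_iff]
        rw [Finset.card_insert_of_notMem hvI] at this
        omega
    · push Not at hloop
      obtain ⟨C, hC, hCs⟩ := hloop
      obtain ⟨D, hD, hDn, hDp⟩ := h𝒞.exists_pos_eq_of_support_eq hC hCs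
      refine SimplicialCpx.CyclesBound.of_link_of_union (G := ∅)
        (fun s hs => dualLink_down_closed hs)
        (mem_dualLink_erase_insert hv) (mem_dualLink_erase hv) (by simp) (by simp) hlink ?_
      rw [Set.union_empty]
      exact cyclesBound_of_forall_subset_mem (Finset.card_pos.1 (by omega)) hD hDn
        (by simp [hDp]) n

end SignedSet

namespace OrientedMatroid

variable {V : Type*} [DecidableEq V]

lemma eliminative_circuits (M : OrientedMatroid V) : SignedSet.Eliminative M.Circuits :=
  ⟨M.support_nonempty, M.negate_mem, M.elimination⟩

lemma Indep.card_le_rank [Fintype V] {M : OrientedMatroid V} {I : Finset V} (hI : M.Indep I) :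
    I.card ≤ M.rank := by
  refine le_csSup ⟨Fintype.card V, ?_⟩ ⟨I, hI, rfl⟩
  rintro _ ⟨J, -, rfl⟩
  exact J.card_le_univ

lemma notMem_suppComplex_faces {M : OrientedMatroid V} {A : Finset V} :
    A ∉ M.suppComplex.faces ↔ ∃ C ∈ M.Circuits, C.neg = ∅ ∧ C.pos ⊆ A := by
  simp only [suppComplex, PosCircuit, Set.mem_ofPred_eq]
  push Not
  constructor
  · rintro ⟨_, hA, C, hC, hn, rfl⟩
    exact ⟨C, hC, hn, hA⟩
  · rintro ⟨C, hC, hn, hA⟩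
    exact ⟨C.pos, hA, C, hC, hn, rfl⟩

lemma dual_suppComplex_induce_faces {V : Type*} [LinearOrder V] [Fintype V]
    (M : OrientedMatroid V) (h : (Finset.univ : Finset V) ∉ M.suppComplex.faces) (S : Finset V) :
    ((M.suppComplex.dual h).induce ↑S).faces =
      SignedSet.dualLink M.Circuits (Finset.univ \ S) S := by
  ext F
  simp only [SimplicialCpx.induce, SimplicialCpx.dual, SignedSet.dualLink, Set.mem_ofPred_eq,
    Finset.coe_subset]
  rw [notMem_suppComplex_faces, and_comm]
  refine and_congr_right fun hF => ?_
  have : Finset.univ \ F = (Finset.univ \ S) ∪ (S \ F) := by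
    ext x
    have := @hF x
    simp only [Finset.mem_sdiff, Finset.mem_union, Finset.mem_univ, true_and]
    tauto
  rw [this]

end OrientedMatroid

/-- Let `M` be a loopless oriented matroid of rank `r` with a positive circuit,
`X` its support complex on finite ground set `V` (so `V ∉ X`, with witness `h`),
and `S ⊊ V` a proper subset with `V - S ∈ X`.  Then `H̃ᵢ(X^⋆[S];ℚ) = 0` for all
`i ≤ |S| - r - 2` (in our indexing `redH n = H̃_{n-1}` vanishes for
`n + r + 1 ≤ |S|`), i.e. `η(X^⋆[S]) ≥ |S| - r`. -/
theorem dual_suppComplex_induce_homology {V : Type*} [LinearOrder V] [Fintype V]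
    (M : OrientedMatroid V) (hM : M.Loopless) (r : ℕ) (hr : M.rank = r)
    (hpc : ∃ T : Finset V, M.PosCircuit T)
    (h : (Finset.univ : Finset V) ∉ M.suppComplex.faces)
    (S : Finset V) (hSproper : S ⊂ Finset.univ)
    (hTS : Finset.univ \ S ∈ M.suppComplex.faces) :
    (∀ n : ℕ, n + r + 1 ≤ S.card →
      Subsingleton (((M.suppComplex.dual h).induce ↑S).redH n)) ∧
    ((S.card - r : ℕ) : ℕ∞) ≤ ((M.suppComplex.dual h).induce ↑S).eta := by
  have hvanish : ∀ n : ℕ, n + r + 1 ≤ S.card →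
      Subsingleton (((M.suppComplex.dual h).induce ↑S).redH n) := by
    intro n hn
    refine SimplicialCpx.CyclesBound.subsingleton_redH ?_
    rw [M.dual_suppComplex_induce_faces h S]
    refine M.eliminative_circuits.cyclesBound_dualLink
      (Finset.sdiff_nonempty.2 hSproper.2) Finset.sdiff_disjoint (fun I _ hI => ?_) hn
    exact hr ▸ OrientedMatroid.Indep.card_le_rank hI
  refine ⟨hvanish, le_sInf ?_⟩
  rintro _ ⟨m, rfl, hm⟩
  by_contra hlt
  have hlt' : m < S.card - r := by exact_mod_cast not_le.1 hlt
  have := hvanish m (by omega)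
  exact not_subsingleton _ this
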